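/- arXiv:2211.03197 — 5 statements merged into one kernel-verified Lean document; each statement's English description precedes it below -/
import Mathlib

section
/- Let g be a C² function on an open set U ⊆ ℝ⁴ with coordinates (x₀,x₁,x₂,x₃). For λ ∈ ℝ let α_λ be the 1-form with components A₀(λ) = 1 − λg₃ − λ²g₂ − λ³g₁, A₁(λ) = λ − λ²g₃ − λ³g₂, A₂(λ) = λ² − λ³g₃, A₃(λ) = λ³. Then the Frobenius condition α_λ ∧ dα_λ = 0 holds on U for every λ ∈ ℝ — explicitly, for every 0 ≤ i < j < k ≤ 3 and every λ: A_i(∂_jA_k − ∂_kA_j) − A_j(∂_iA_k − ∂_kA_i) + A_k(∂_iA_j − ∂_jA_i) = 0 on U — if and only if g satisfies the universal hierarchy system (I)–(IV) on U. -/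
/-- Partial derivative `∂f/∂x_j` on ℝ⁴. -/
noncomputable def pd (f : (Fin 4 → ℝ) → ℝ) (j : Fin 4) (x : Fin 4 → ℝ) : ℝ :=
  fderiv ℝ f x (Pi.single j 1)

/-- Second partial derivative `∂²f/∂x_i∂x_j` on ℝ⁴. -/
noncomputable def pd2 (f : (Fin 4 → ℝ) → ℝ) (i j : Fin 4) (x : Fin 4 → ℝ) : ℝ :=
  pd (pd f j) i x

/-- The components of the 1-form `α_λ`:
`A₀ = 1 − λg₃ − λ²g₂ − λ³g₁`, `A₁ = λ − λ²g₃ − λ³g₂`, `A₂ = λ² − λ³g₃`, `A₃ = λ³`. -/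
noncomputable def A (g : (Fin 4 → ℝ) → ℝ) (lam : ℝ) : Fin 4 → (Fin 4 → ℝ) → ℝ :=
  ![fun y => 1 - lam * pd g 3 y - lam ^ 2 * pd g 2 y - lam ^ 3 * pd g 1 y,
    fun y => lam - lam ^ 2 * pd g 3 y - lam ^ 3 * pd g 2 y,
    fun y => lam ^ 2 - lam ^ 3 * pd g 3 y,
    fun _ => lam ^ 3]

/-- Partial derivatives of a C² function on an open set are differentiable there. -/
lemma differentiableAt_pd {U : Set (Fin 4 → ℝ)} (hU : IsOpen U) {g : (Fin 4 → ℝ) → ℝ}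
    (hg : ContDiffOn ℝ 2 g U) {x : Fin 4 → ℝ} (hx : x ∈ U) (i : Fin 4) :
    DifferentiableAt ℝ (pd g i) x := by
  have h : ContDiffAt ℝ 1 (fderiv ℝ g) x :=
    (hg.contDiffAt (hU.mem_nhds hx)).fderiv_right (by norm_num)
  exact (h.differentiableAt one_ne_zero).clm_apply (differentiableAt_const _)

/-- Mixed second partial derivatives of a C² function commute. -/
lemma pd2_comm {U : Set (Fin 4 → ℝ)} (hU : IsOpen U) {g : (Fin 4 → ℝ) → ℝ}
    (hg : ContDiffOn ℝ 2 g U) {x : Fin 4 → ℝ} (hx : x ∈ U) (i j : Fin 4) :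
    pd2 g i j x = pd2 g j i x := by
  have hgx : ContDiffAt ℝ 2 g x := hg.contDiffAt (hU.mem_nhds hx)
  have h : ContDiffAt ℝ 1 (fderiv ℝ g) x := hgx.fderiv_right (by norm_num)
  have hd := h.differentiableAt one_ne_zero
  have key (a b : Fin 4) :
      pd2 g a b x = fderiv ℝ (fderiv ℝ g) x (Pi.single a 1) (Pi.single b 1) := by
    change fderiv ℝ (fun y => fderiv ℝ g y (Pi.single b 1)) x (Pi.single a 1) = _
    rw [fderiv_clm_apply hd (differentiableAt_const _)]
    simp
  rw [key, key]
  exact (hgx.isSymmSndFDerivAt (by simp)).eq _ _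

/-- Partial derivatives of an affine combination of three differentiable functions. -/
lemma pd_const_sub_sub_sub {f₁ f₂ f₃ : (Fin 4 → ℝ) → ℝ} {x : Fin 4 → ℝ}
    (h₁ : DifferentiableAt ℝ f₁ x) (h₂ : DifferentiableAt ℝ f₂ x)
    (h₃ : DifferentiableAt ℝ f₃ x) (c a₁ a₂ a₃ : ℝ) (j : Fin 4) :
    pd (fun y => c - a₁ * f₁ y - a₂ * f₂ y - a₃ * f₃ y) j x
      = -(a₁ * pd f₁ j x) - a₂ * pd f₂ j x - a₃ * pd f₃ j x := by
  have h := (((h₁.hasFDerivAt.const_mul a₁).const_sub c).sub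
    (h₂.hasFDerivAt.const_mul a₂)).sub (h₃.hasFDerivAt.const_mul a₃)
  exact (DFunLike.congr_fun h.fderiv _).trans (by simp [pd])

section PartialDerivatives

variable {U : Set (Fin 4 → ℝ)} {g : (Fin 4 → ℝ) → ℝ} {x : Fin 4 → ℝ}

lemma pd_A_zero (hU : IsOpen U) (hg : ContDiffOn ℝ 2 g U) (hx : x ∈ U) (lam : ℝ) (j : Fin 4) :
    pd (A g lam 0) j x
      = -(lam * pd2 g j 3 x) - lam ^ 2 * pd2 g j 2 x - lam ^ 3 * pd2 g j 1 x :=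
  have hd := differentiableAt_pd hU hg hx
  pd_const_sub_sub_sub (hd 3) (hd 2) (hd 1) 1 lam (lam ^ 2) (lam ^ 3) j

lemma pd_A_one (hU : IsOpen U) (hg : ContDiffOn ℝ 2 g U) (hx : x ∈ U) (lam : ℝ) (j : Fin 4) :
    pd (A g lam 1) j x = -(lam ^ 2 * pd2 g j 3 x) - lam ^ 3 * pd2 g j 2 x := by
  have hd := differentiableAt_pd hU hg hx
  simpa [A, pd2] using
    pd_const_sub_sub_sub (hd 3) (hd 2) (hd 1) lam (lam ^ 2) (lam ^ 3) 0 j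

lemma pd_A_two (hU : IsOpen U) (hg : ContDiffOn ℝ 2 g U) (hx : x ∈ U) (lam : ℝ) (j : Fin 4) :
    pd (A g lam 2) j x = -(lam ^ 3 * pd2 g j 3 x) := by
  have hd := differentiableAt_pd hU hg hx
  simpa [A, pd2] using
    pd_const_sub_sub_sub (hd 3) (hd 2) (hd 1) (lam ^ 2) (lam ^ 3) 0 0 j

lemma pd_A_three (lam : ℝ) (j : Fin 4) : pd (A g lam 3) j x = 0 := by
  simp [A, pd]

end PartialDerivatives

/-- The component of `α ∧ dα` along `dx_i ∧ dx_j ∧ dx_k`, for `α = ∑ a_i dx_i`. -/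
noncomputable def wedgeComponent (a : Fin 4 → (Fin 4 → ℝ) → ℝ) (i j k : Fin 4)
    (x : Fin 4 → ℝ) : ℝ :=
  a i x * (pd (a k) j x - pd (a j) k x) - a j x * (pd (a k) i x - pd (a i) k x)
    + a k x * (pd (a j) i x - pd (a i) j x)

section WedgeComponents

variable {U : Set (Fin 4 → ℝ)} {g : (Fin 4 → ℝ) → ℝ} {x : Fin 4 → ℝ}

lemma wedgeComponent_A_zero_one_two (hU : IsOpen U)
    (hg : ContDiffOn ℝ 2 g U) (hx : x ∈ U) (lam : ℝ) :
    wedgeComponent (A g lam) 0 1 2 x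
      = lam ^ 5 * (pd g 2 x * pd2 g 1 3 x - pd g 1 x * pd2 g 2 3 x
          + pd2 g 1 1 x - pd2 g 0 2 x)
        + lam ^ 6 * (pd g 3 x * pd2 g 0 2 x - pd g 3 x * pd2 g 1 1 x + pd g 2 x * pd2 g 1 2 x
          - pd g 2 x * pd2 g 0 3 x + pd g 1 x * pd2 g 1 3 x - pd g 1 x * pd2 g 2 2 x) := by
  rw [wedgeComponent]
  simp only [pd_A_zero hU hg hx, pd_A_one hU hg hx, pd_A_two hU hg hx,
    pd2_comm hU hg hx 2 1]
  simp only [A, Matrix.cons_val]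
  ring

lemma wedgeComponent_A_zero_one_three (hU : IsOpen U)
    (hg : ContDiffOn ℝ 2 g U) (hx : x ∈ U) (lam : ℝ) :
    wedgeComponent (A g lam) 0 1 3 x
      = lam ^ 5 * (pd g 3 x * pd2 g 1 3 x - pd g 1 x * pd2 g 3 3 x
          + pd2 g 1 2 x - pd2 g 0 3 x)
        + lam ^ 6 * (pd g 2 x * pd2 g 1 3 x - pd g 1 x * pd2 g 2 3 x
          + pd2 g 1 1 x - pd2 g 0 2 x) := by
  rw [wedgeComponent]
  simp only [pd_A_zero hU hg hx, pd_A_one hU hg hx, pd_A_three,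
    pd2_comm hU hg hx 3 1, pd2_comm hU hg hx 3 2]
  simp only [A, Matrix.cons_val]
  ring

lemma wedgeComponent_A_zero_two_three (hU : IsOpen U)
    (hg : ContDiffOn ℝ 2 g U) (hx : x ∈ U) (lam : ℝ) :
    wedgeComponent (A g lam) 0 2 3 x
      = lam ^ 5 * (pd g 3 x * pd2 g 2 3 x - pd g 2 x * pd2 g 3 3 x
          + pd2 g 2 2 x - pd2 g 1 3 x)
        + lam ^ 6 * (pd g 3 x * pd2 g 1 3 x - pd g 1 x * pd2 g 3 3 x
          + pd2 g 1 2 x - pd2 g 0 3 x) := by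
  rw [wedgeComponent]
  simp only [pd_A_zero hU hg hx, pd_A_two hU hg hx, pd_A_three,
    pd2_comm hU hg hx 2 1, pd2_comm hU hg hx 3 1, pd2_comm hU hg hx 3 2]
  simp only [A, Matrix.cons_val]
  ring

lemma wedgeComponent_A_one_two_three (hU : IsOpen U)
    (hg : ContDiffOn ℝ 2 g U) (hx : x ∈ U) (lam : ℝ) :
    wedgeComponent (A g lam) 1 2 3 x
      = lam ^ 6 * (pd g 3 x * pd2 g 2 3 x - pd g 2 x * pd2 g 3 3 x
          + pd2 g 2 2 x - pd2 g 1 3 x) := by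
  rw [wedgeComponent]
  simp only [pd_A_one hU hg hx, pd_A_two hU hg hx, pd_A_three,
    pd2_comm hU hg hx 3 2]
  simp only [A, Matrix.cons_val]
  ring

end WedgeComponents

/-- For a C² function `g` on an open `U ⊆ ℝ⁴`, the Frobenius condition
`α_λ ∧ dα_λ = 0` holds on `U` for every `λ ∈ ℝ` (explicitly, for every `i < j < k`
and every `λ`: `A_i(∂_jA_k − ∂_kA_j) − A_j(∂_iA_k − ∂_kA_i) + A_k(∂_iA_j − ∂_jA_i) = 0`
on `U`) if and only if `g` satisfies the universal hierarchy system (I)–(IV) on `U`. -/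
theorem frobenius_iff_universal_hierarchy
    (U : Set (Fin 4 → ℝ)) (hU : IsOpen U)
    (g : (Fin 4 → ℝ) → ℝ) (hg : ContDiffOn ℝ 2 g U) :
    (∀ i j k : Fin 4, i < j → j < k → ∀ lam : ℝ, ∀ x ∈ U,
      A g lam i x * (pd (A g lam k) j x - pd (A g lam j) k x)
      - A g lam j x * (pd (A g lam k) i x - pd (A g lam i) k x)
      + A g lam k x * (pd (A g lam j) i x - pd (A g lam i) j x) = 0)
    ↔
    (∀ x ∈ U,
      (pd g 2 x * pd2 g 1 3 x - pd g 1 x * pd2 g 2 3 x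
        + pd2 g 1 1 x - pd2 g 0 2 x = 0)
      ∧
      (pd g 3 x * pd2 g 1 3 x - pd g 1 x * pd2 g 3 3 x
        + pd2 g 1 2 x - pd2 g 0 3 x = 0)
      ∧
      (pd g 3 x * pd2 g 2 3 x - pd g 2 x * pd2 g 3 3 x
        + pd2 g 2 2 x - pd2 g 1 3 x = 0)
      ∧
      (pd g 3 x * pd2 g 0 2 x - pd g 3 x * pd2 g 1 1 x + pd g 2 x * pd2 g 1 2 x
        - pd g 2 x * pd2 g 0 3 x + pd g 1 x * pd2 g 1 3 x - pd g 1 x * pd2 g 2 2 x = 0)) := by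
  change (∀ i j k : Fin 4, i < j → j < k → ∀ lam : ℝ, ∀ x ∈ U,
    wedgeComponent (A g lam) i j k x = 0) ↔ _
  constructor
  · intro h x hx
    have h012 := h 0 1 2 (by decide) (by decide) 1 x hx
    have h013 := h 0 1 3 (by decide) (by decide) 1 x hx
    have h023 := h 0 2 3 (by decide) (by decide) 1 x hx
    have h123 := h 1 2 3 (by decide) (by decide) 1 x hx
    rw [wedgeComponent_A_zero_one_two hU hg hx] at h012
    rw [wedgeComponent_A_zero_one_three hU hg hx] at h013
    rw [wedgeComponent_A_zero_two_three hU hg hx] at h023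
    rw [wedgeComponent_A_one_two_three hU hg hx] at h123
    refine ⟨?_, ?_, ?_, ?_⟩
    · linear_combination h013 - h023 + h123
    · linear_combination h023 - h123
    · linear_combination h123
    · linear_combination h012 - h013 + h023 - h123
  · intro h i j k hij hjk lam x hx
    obtain ⟨h1, h2, h3, h4⟩ := h x hx
    have hcases : i = 0 ∧ j = 1 ∧ k = 2 ∨ i = 0 ∧ j = 1 ∧ k = 3 ∨ i = 0 ∧ j = 2 ∧ k = 3 ∨
        i = 1 ∧ j = 2 ∧ k = 3 := by omega
    rcases hcases with ⟨rfl, rfl, rfl⟩ | ⟨rfl, rfl, rfl⟩ | ⟨rfl, rfl, rfl⟩ | ⟨rfl, rfl, rfl⟩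
    · rw [wedgeComponent_A_zero_one_two hU hg hx, h1, h4]; ring
    · rw [wedgeComponent_A_zero_one_three hU hg hx, h1, h2]; ring
    · rw [wedgeComponent_A_zero_two_three hU hg hx, h2, h3]; ring
    · rw [wedgeComponent_A_one_two_three hU hg hx, h3]; ring
end

section
/- Let λ₁,λ₂,λ₃,λ₄ be pairwise distinct real constants and let f be twice differentiable at a point x ∈ ℝ⁴ with (f₁(x),f₂(x),f₃(x),f₄(x)) ≠ (0,0,0,0). If the four equations of the dispersionless Hirota system (case A₄) hold at x, then the general heavenly equation (λ₁−λ₂)(λ₃−λ₄)f₁₂f₃₄ − (λ₁−λ₃)(λ₂−λ₄)f₁₃f₂₄ + (λ₁−λ₄)(λ₂−λ₃)f₁₄f₂₃ = 0 holds at x. -/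
/-- If a nonzero vector `v` and a 2-form `a` in four dimensions satisfy `v ∧ a = 0`,
then the Pfaffian of `a` vanishes. -/
theorem pfaffian_eq_zero_of_wedge_eq_zero {R : Type*} [CommRing R] [NoZeroDivisors R]
    {v₀ v₁ v₂ v₃ a₀₁ a₀₂ a₀₃ a₁₂ a₁₃ a₂₃ : R}
    (hv : ¬ (v₀ = 0 ∧ v₁ = 0 ∧ v₂ = 0 ∧ v₃ = 0))
    (h₀₁₂ : v₀ * a₁₂ - v₁ * a₀₂ + v₂ * a₀₁ = 0)
    (h₀₁₃ : v₀ * a₁₃ - v₁ * a₀₃ + v₃ * a₀₁ = 0)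
    (h₀₂₃ : v₀ * a₂₃ - v₂ * a₀₃ + v₃ * a₀₂ = 0)
    (h₁₂₃ : v₁ * a₂₃ - v₂ * a₁₃ + v₃ * a₁₂ = 0) :
    a₀₁ * a₂₃ - a₀₂ * a₁₃ + a₀₃ * a₁₂ = 0 := by
  by_contra hP
  refine hv ⟨?_, ?_, ?_, ?_⟩ <;> refine (mul_eq_zero.mp ?_).resolve_right hP
  · linear_combination a₀₁ * h₀₂₃ - a₀₂ * h₀₁₃ + a₀₃ * h₀₁₂
  · linear_combination a₀₁ * h₁₂₃ - a₁₂ * h₀₁₃ + a₁₃ * h₀₁₂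
  · linear_combination a₂₃ * h₀₁₂ - a₁₂ * h₀₂₃ + a₀₂ * h₁₂₃
  · linear_combination a₂₃ * h₀₁₃ - a₁₃ * h₀₂₃ + a₀₃ * h₁₂₃

/-- Let `λ₁,…,λ₄` (here `L 0,…,L 3`) be pairwise distinct constants and `f`
twice differentiable at `x` with nonvanishing gradient at `x`. If the four equations
of the dispersionless Hirota system (case A₄) hold at `x`, then the general heavenly
equation holds at `x`. (1-based indices of the paper correspond to `Fin 4` indices.) -/
theorem hirota_implies_general_heavenly
    (L : Fin 4 → ℝ) (hL : ∀ i j : Fin 4, i ≠ j → L i ≠ L j)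
    (f : (Fin 4 → ℝ) → ℝ) (x : Fin 4 → ℝ) (hf : ContDiffAt ℝ 2 f x)
    (hgrad : ¬ (pd f 0 x = 0 ∧ pd f 1 x = 0 ∧ pd f 2 x = 0 ∧ pd f 3 x = 0))
    (h1 : pd f 0 x * pd2 f 1 2 x * (L 1 - L 2) + pd f 1 x * pd2 f 0 2 x * (L 2 - L 0)
          + pd f 2 x * pd2 f 0 1 x * (L 0 - L 1) = 0)
    (h2 : pd f 0 x * pd2 f 1 3 x * (L 1 - L 3) + pd f 1 x * pd2 f 0 3 x * (L 3 - L 0)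
          + pd f 3 x * pd2 f 0 1 x * (L 0 - L 1) = 0)
    (h3 : pd f 0 x * pd2 f 2 3 x * (L 2 - L 3) + pd f 2 x * pd2 f 0 3 x * (L 3 - L 0)
          + pd f 3 x * pd2 f 0 2 x * (L 0 - L 2) = 0)
    (h4 : pd f 1 x * pd2 f 2 3 x * (L 2 - L 3) + pd f 2 x * pd2 f 1 3 x * (L 3 - L 1)
          + pd f 3 x * pd2 f 1 2 x * (L 1 - L 2) = 0) :
    (L 0 - L 1) * (L 2 - L 3) * pd2 f 0 1 x * pd2 f 2 3 x
    - (L 0 - L 2) * (L 1 - L 3) * pd2 f 0 2 x * pd2 f 1 3 x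
    + (L 0 - L 3) * (L 1 - L 2) * pd2 f 0 3 x * pd2 f 1 2 x = 0 := by
  have key := pfaffian_eq_zero_of_wedge_eq_zero (a₀₁ := (L 0 - L 1) * pd2 f 0 1 x)
    (a₀₂ := (L 0 - L 2) * pd2 f 0 2 x) (a₀₃ := (L 0 - L 3) * pd2 f 0 3 x)
    (a₁₂ := (L 1 - L 2) * pd2 f 1 2 x) (a₁₃ := (L 1 - L 3) * pd2 f 1 3 x)
    (a₂₃ := (L 2 - L 3) * pd2 f 2 3 x) hgrad
    (by linear_combination h1) (by linear_combination h2)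
    (by linear_combination h3) (by linear_combination h4)
  linear_combination key
end

section
/- Let f be twice differentiable at a point x ∈ ℝ⁴ whose coordinates x₁,x₂,x₃,x₄ are pairwise distinct and such that (f₁(x),f₂(x),f₃(x),f₄(x)) ≠ (0,0,0,0). If the four equations of the dispersionless Hirota system (case A₀) hold at x, then the heavenly equation (case A₀) (x₁−x₂)(x₃−x₄)f₁₂f₃₄ − (x₁−x₃)(x₂−x₄)f₁₃f₂₄ + (x₁−x₄)(x₂−x₃)f₁₄f₂₃ = 0 holds at x. -/
/-- Let `f` be twice differentiable at a point `x ∈ ℝ⁴` with pairwise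
distinct coordinates and nonvanishing gradient at `x`. If the four equations of the
dispersionless Hirota system (case A₀) hold at `x`, then the heavenly equation
(case A₀) holds at `x`. (1-based indices of the paper correspond to `Fin 4` indices.) -/
theorem hirota_A0_implies_heavenly_A0
    (f : (Fin 4 → ℝ) → ℝ) (x : Fin 4 → ℝ) (hf : ContDiffAt ℝ 2 f x)
    (hx : ∀ i j : Fin 4, i ≠ j → x i ≠ x j)
    (hgrad : ¬ (pd f 0 x = 0 ∧ pd f 1 x = 0 ∧ pd f 2 x = 0 ∧ pd f 3 x = 0))
    (h1 : pd f 0 x * pd2 f 1 2 x * (x 1 - x 2) + pd f 1 x * pd2 f 0 2 x * (x 2 - x 0)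
          + pd f 2 x * pd2 f 0 1 x * (x 0 - x 1) = 0)
    (h2 : pd f 0 x * pd2 f 1 3 x * (x 1 - x 3) + pd f 1 x * pd2 f 0 3 x * (x 3 - x 0)
          + pd f 3 x * pd2 f 0 1 x * (x 0 - x 1) = 0)
    (h3 : pd f 0 x * pd2 f 2 3 x * (x 2 - x 3) + pd f 2 x * pd2 f 0 3 x * (x 3 - x 0)
          + pd f 3 x * pd2 f 0 2 x * (x 0 - x 2) = 0)
    (h4 : pd f 1 x * pd2 f 2 3 x * (x 2 - x 3) + pd f 2 x * pd2 f 1 3 x * (x 3 - x 1)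
          + pd f 3 x * pd2 f 1 2 x * (x 1 - x 2) = 0) :
    (x 0 - x 1) * (x 2 - x 3) * pd2 f 0 1 x * pd2 f 2 3 x
    - (x 0 - x 2) * (x 1 - x 3) * pd2 f 0 2 x * pd2 f 1 3 x
    + (x 0 - x 3) * (x 1 - x 2) * pd2 f 0 3 x * pd2 f 1 2 x = 0 := by
  by_contra hne
  refine hgrad ⟨?_, ?_, ?_, ?_⟩ <;> refine (mul_eq_zero.mp ?_).resolve_right hne
  · linear_combination
      ((x 0 - x 3) * pd2 f 0 3 x) * h1
      - ((x 0 - x 2) * pd2 f 0 2 x) * h2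
      + ((x 0 - x 1) * pd2 f 0 1 x) * h3
  · linear_combination
      ((x 1 - x 3) * pd2 f 1 3 x) * h1
      - ((x 1 - x 2) * pd2 f 1 2 x) * h2
      + ((x 0 - x 1) * pd2 f 0 1 x) * h4
  · linear_combination
      ((x 2 - x 3) * pd2 f 2 3 x) * h1
      - ((x 1 - x 2) * pd2 f 1 2 x) * h3
      + ((x 0 - x 2) * pd2 f 0 2 x) * h4
  · linear_combination
      ((x 2 - x 3) * pd2 f 2 3 x) * h2
      - ((x 1 - x 3) * pd2 f 1 3 x) * h3
      + ((x 0 - x 3) * pd2 f 0 3 x) * h4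
end

section
/- Let λ₁,λ₂,λ₃,λ₄ be pairwise distinct real constants and let f be a C³ function on an open set U ⊆ ℝ⁴ with f₁₂ nowhere zero on U, satisfying the general heavenly equation (λ₁−λ₂)(λ₃−λ₄)f₁₂f₃₄ − (λ₁−λ₃)(λ₂−λ₄)f₁₃f₂₄ + (λ₁−λ₄)(λ₂−λ₃)f₁₄f₂₃ = 0 on U. Then for every λ ∈ ℝ the vector fields X₁(λ) = (f₂₄(λ₂−λ₄)/(f₁₂(λ₁−λ₂)))(λ₁−λ)∂₁ − (f₁₄(λ₁−λ₄)/(f₁₂(λ₁−λ₂)))(λ₂−λ)∂₂ + (λ₄−λ)∂₄ and X₂(λ) = (f₂₃(λ₂−λ₃)/(f₁₂(λ₁−λ₂)))(λ₁−λ)∂₁ − (f₁₃(λ₁−λ₃)/(f₁₂(λ₁−λ₂)))(λ₂−λ)∂₂ + (λ₃−λ)∂₃ commute on U: [X₁(λ),X₂(λ)] = 0. -/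
open scoped BigOperators

/-- Lie bracket of vector fields on ℝ⁴:
`[X,Y]^i = ∑_j (X^j ∂_j Y^i − Y^j ∂_j X^i)`. -/
noncomputable def lieB (X Y : (Fin 4 → ℝ) → (Fin 4 → ℝ)) (x : Fin 4 → ℝ) : Fin 4 → ℝ :=
  fun i => ∑ j, (X x j * pd (fun y => Y y i) j x - Y x j * pd (fun y => X y i) j x)

open scoped ContDiff Topology

section PartialDerivatives

variable {f g : (Fin 4 → ℝ) → ℝ} {x : Fin 4 → ℝ}

theorem pd_const (c : ℝ) (j : Fin 4) (x : Fin 4 → ℝ) : pd (fun _ => c) j x = 0 := by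
  simp [pd]

theorem pd_congr (h : f =ᶠ[𝓝 x] g) (j : Fin 4) : pd f j x = pd g j x := by
  simp only [pd, h.fderiv_eq]

theorem pd_add (hf : DifferentiableAt ℝ f x) (hg : DifferentiableAt ℝ g x) (j : Fin 4) :
    pd (fun y => f y + g y) j x = pd f j x + pd g j x := by
  simp [pd, fderiv_fun_add hf hg]

theorem pd_sub (hf : DifferentiableAt ℝ f x) (hg : DifferentiableAt ℝ g x) (j : Fin 4) :
    pd (fun y => f y - g y) j x = pd f j x - pd g j x := by
  simp [pd, fderiv_fun_sub hf hg]

theorem pd_const_mul_mul (hf : DifferentiableAt ℝ f x) (hg : DifferentiableAt ℝ g x)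
    (c : ℝ) (j : Fin 4) :
    pd (fun y => c * f y * g y) j x = c * (pd f j x * g x + f x * pd g j x) := by
  simp only [pd, fderiv_fun_mul (hf.const_mul c) hg, fderiv_const_mul hf]
  simp
  ring

/-- The quotient rule, for a constant multiple of `f / g`. -/
theorem pd_const_mul_div (hf : DifferentiableAt ℝ f x) (hg : DifferentiableAt ℝ g x)
    (h0 : g x ≠ 0) (c : ℝ) (j : Fin 4) :
    pd (fun y => c * (f y / g y)) j x =
      c * ((pd f j x * g x - f x * pd g j x) / g x ^ 2) := by
  have h := ((hf.hasFDerivAt.fun_mul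
    ((hasDerivAt_inv h0).comp_hasFDerivAt x hg.hasFDerivAt)).const_mul c).fderiv
  simp only [Function.comp_def, ← div_eq_mul_inv] at h
  simp only [pd, h]
  simp
  field_simp
  ring

theorem ContDiffAt.pd {m n : ℕ∞ω} (hf : ContDiffAt ℝ n f x) (hmn : m + 1 ≤ n) (j : Fin 4) :
    ContDiffAt ℝ m (pd f j) x :=
  (hf.fderiv_right hmn).clm_apply contDiffAt_const

/-- Equality of mixed second partial derivatives. -/
theorem pd2_comm_s9 (hf : ContDiffAt ℝ 2 f x) (i j : Fin 4) : pd2 f i j x = pd2 f j i x := by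
  have hd : DifferentiableAt ℝ (fderiv ℝ f) x :=
    (hf.fderiv_right (m := 1) (by norm_num)).differentiableAt one_ne_zero
  have key (i j : Fin 4) :
      pd2 f i j x = fderiv ℝ (fderiv ℝ f) x (Pi.single i 1) (Pi.single j 1) := by
    change fderiv ℝ (fun y => fderiv ℝ f y (Pi.single j 1)) x (Pi.single i 1) = _
    rw [fderiv_clm_apply hd (differentiableAt_const _)]
    simp
  rw [key, key]
  exact (hf.isSymmSndFDerivAt (by simp)).eq _ _

theorem differentiableAt_pd2 (hf : ContDiffAt ℝ 3 f x) (i j : Fin 4) :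
    DifferentiableAt ℝ (pd2 f i j) x :=
  ((hf.pd (m := 2) (by norm_num) j).pd (m := 1) (by norm_num) i).differentiableAt one_ne_zero

theorem pd_pd2_comm_left (hf : ContDiffAt ℝ 3 f x) (i j k : Fin 4) :
    pd (pd2 f j k) i x = pd (pd2 f i k) j x :=
  pd2_comm_s9 (hf.pd (m := 2) (by norm_num) k) i j

theorem pd_pd2_comm_right (hf : ContDiffAt ℝ 3 f x) (i j k : Fin 4) :
    pd (pd2 f j k) i x = pd (pd2 f k j) i x := by
  refine pd_congr ?_ i
  filter_upwards [hf.eventually (by simp)] with y hy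
  exact pd2_comm_s9 (hy.of_le (by norm_num)) j k

end PartialDerivatives

/-- If `f` is C³ on an open `U ⊆ ℝ⁴` with `f₁₂` nowhere zero and satisfies
the general heavenly equation (case A₄, with pairwise distinct constants
`λ₁,…,λ₄ = L 0,…,L 3`), then for every `λ` the Lax pair vector fields `X₁(λ), X₂(λ)`
commute on `U`. -/
theorem general_heavenly_lax_pair_commutes
    (L : Fin 4 → ℝ) (hL : ∀ i j : Fin 4, i ≠ j → L i ≠ L j)
    (U : Set (Fin 4 → ℝ)) (hU : IsOpen U)
    (f : (Fin 4 → ℝ) → ℝ) (hf : ContDiffOn ℝ 3 f U)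
    (hf12 : ∀ x ∈ U, pd2 f 0 1 x ≠ 0)
    (heq : ∀ x ∈ U,
      (L 0 - L 1) * (L 2 - L 3) * pd2 f 0 1 x * pd2 f 2 3 x
      - (L 0 - L 2) * (L 1 - L 3) * pd2 f 0 2 x * pd2 f 1 3 x
      + (L 0 - L 3) * (L 1 - L 2) * pd2 f 0 3 x * pd2 f 1 2 x = 0) :
    ∀ lam : ℝ, ∀ x ∈ U,
      lieB
        (fun y =>
          ![pd2 f 1 3 y * (L 1 - L 3) / (pd2 f 0 1 y * (L 0 - L 1)) * (L 0 - lam),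
            -(pd2 f 0 3 y * (L 0 - L 3) / (pd2 f 0 1 y * (L 0 - L 1))) * (L 1 - lam),
            0,
            L 3 - lam])
        (fun y =>
          ![pd2 f 1 2 y * (L 1 - L 2) / (pd2 f 0 1 y * (L 0 - L 1)) * (L 0 - lam),
            -(pd2 f 0 2 y * (L 0 - L 2) / (pd2 f 0 1 y * (L 0 - L 1))) * (L 1 - lam),
            L 2 - lam,
            0])
        x = 0 := by
  intro lam x hx
  have hfx : ContDiffAt ℝ 3 f x := hf.contDiffAt (hU.mem_nhds hx)
  have hd := differentiableAt_pd2 hfx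
  have hw : L 0 - L 1 ≠ 0 := sub_ne_zero.2 (hL 0 1 (by decide))
  have hg := hf12 x hx
  have hE := heq x hx
  have hdE (k : Fin 4) :
      (L 0 - L 1) * (L 2 - L 3) *
          (pd (pd2 f 0 1) k x * pd2 f 2 3 x + pd2 f 0 1 x * pd (pd2 f 2 3) k x)
        - (L 0 - L 2) * (L 1 - L 3) *
          (pd (pd2 f 0 2) k x * pd2 f 1 3 x + pd2 f 0 2 x * pd (pd2 f 1 3) k x)
        + (L 0 - L 3) * (L 1 - L 2) *
          (pd (pd2 f 0 3) k x * pd2 f 1 2 x + pd2 f 0 3 x * pd (pd2 f 1 2) k x) = 0 := by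
    have hprod (c : ℝ) (i j i' j' : Fin 4) :
        DifferentiableAt ℝ (fun y => c * pd2 f i j y * pd2 f i' j' y) x :=
      ((hd i j).const_mul c).mul (hd i' j')
    rw [← pd_const_mul_mul (hd 0 1) (hd 2 3), ← pd_const_mul_mul (hd 0 2) (hd 1 3),
      ← pd_const_mul_mul (hd 0 3) (hd 1 2), ← pd_sub (hprod _ _ _ _ _) (hprod _ _ _ _ _),
      ← pd_add ((hprod _ _ _ _ _).fun_sub (hprod _ _ _ _ _)) (hprod _ _ _ _ _),
      ← pd_const 0 k x]
    refine pd_congr ?_ k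
    filter_upwards [hU.mem_nhds hx] with y hy using heq y hy
  have hpos (i j k : Fin 4) (r s : ℝ) :
      pd (fun y => pd2 f i j y * r / (pd2 f 0 1 y * (L 0 - L 1)) * s) k x =
        r * s / (L 0 - L 1) * ((pd (pd2 f i j) k x * pd2 f 0 1 x
          - pd2 f i j x * pd (pd2 f 0 1) k x) / pd2 f 0 1 x ^ 2) := by
    rw [← pd_const_mul_div (hd i j) (hd 0 1) hg]
    congr 1
    funext y
    simp only [div_eq_mul_inv, mul_inv]
    ring
  have hneg (i j k : Fin 4) (r s : ℝ) :
      pd (fun y => -(pd2 f i j y * r / (pd2 f 0 1 y * (L 0 - L 1))) * s) k x =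
        -(r * s) / (L 0 - L 1) * ((pd (pd2 f i j) k x * pd2 f 0 1 x
          - pd2 f i j x * pd (pd2 f 0 1) k x) / pd2 f 0 1 x ^ 2) := by
    rw [← pd_const_mul_div (hd i j) (hd 0 1) hg]
    congr 1
    funext y
    simp only [div_eq_mul_inv, mul_inv]
    ring
  have hdE0 := hdE 0
  have hdE1 := hdE 1
  have h101 : pd (pd2 f 0 1) 1 x = pd (pd2 f 1 1) 0 x := pd_pd2_comm_left hfx 1 0 1
  have h102 : pd (pd2 f 0 2) 1 x = pd (pd2 f 1 2) 0 x := pd_pd2_comm_left hfx 1 0 2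
  have h103 : pd (pd2 f 0 3) 1 x = pd (pd2 f 1 3) 0 x := pd_pd2_comm_left hfx 1 0 3
  have h201 : pd (pd2 f 0 1) 2 x = pd (pd2 f 1 2) 0 x := by
    rw [pd_pd2_comm_left hfx 2 0 1, pd_pd2_comm_right hfx 0 2 1]
  have h301 : pd (pd2 f 0 1) 3 x = pd (pd2 f 1 3) 0 x := by
    rw [pd_pd2_comm_left hfx 3 0 1, pd_pd2_comm_right hfx 0 3 1]
  have h203 : pd (pd2 f 0 3) 2 x = pd (pd2 f 2 3) 0 x := pd_pd2_comm_left hfx 2 0 3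
  have h213 : pd (pd2 f 1 3) 2 x = pd (pd2 f 2 3) 1 x := pd_pd2_comm_left hfx 2 1 3
  have h302 : pd (pd2 f 0 2) 3 x = pd (pd2 f 2 3) 0 x := by
    rw [pd_pd2_comm_left hfx 3 0 2, pd_pd2_comm_right hfx 0 3 2]
  have h312 : pd (pd2 f 1 2) 3 x = pd (pd2 f 2 3) 1 x := by
    rw [pd_pd2_comm_left hfx 3 1 2, pd_pd2_comm_right hfx 1 3 2]
  rw [h101, h102, h103] at hdE1
  funext i
  fin_cases i <;>
    simp [lieB, Fin.sum_univ_four, pd_const, -neg_mul, hpos, hneg, h101, h102, h103, h201,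
      h301, h203, h213, h302, h312]
  · linear_combination (norm := skip)
      (-((L 0 - lam) * (L 1 - lam)) / ((L 0 - L 1) ^ 2 * pd2 f 0 1 x ^ 2)) * hdE1
      + ((L 0 - lam) * (L 1 - lam) * pd (pd2 f 1 1) 0 x
          / ((L 0 - L 1) ^ 2 * pd2 f 0 1 x ^ 3)) * hE
    field_simp
    ring
  · linear_combination (norm := skip)
      ((L 0 - lam) * (L 1 - lam) / ((L 0 - L 1) ^ 2 * pd2 f 0 1 x ^ 2)) * hdE0
      - ((L 0 - lam) * (L 1 - lam) * pd (pd2 f 0 1) 0 x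
          / ((L 0 - L 1) ^ 2 * pd2 f 0 1 x ^ 3)) * hE
    field_simp
    ring
end

section
/- For every r ∈ ℝ, the function f(x₁,x₂,x₃,x₄) = (x₁−x₄)^r (x₂−x₄)^r (x₃−x₄)^r (real powers), defined on the open set U = {x ∈ ℝ⁴ : x₁ > x₄, x₂ > x₄, x₃ > x₄}, satisfies on U all four equations of the dispersionless Hirota system (case A₀). -/
open ContinuousLinearMap in
/-- The continuous linear functional `y ↦ y k - y 3`. -/
noncomputable def coordSub (k : Fin 4) : (Fin 4 → ℝ) →L[ℝ] ℝ :=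
  proj (R := ℝ) (φ := fun _ : Fin 4 => ℝ) k - proj (R := ℝ) (φ := fun _ : Fin 4 => ℝ) 3

lemma coordSub_apply (k : Fin 4) (v : Fin 4 → ℝ) : coordSub k v = v k - v 3 := rfl

/-- The sum of the logarithmic derivatives of the factors `y k - y 3` in the direction `v`. -/
noncomputable def logDerivSum (v y : Fin 4 → ℝ) : ℝ :=
  coordSub 0 v / coordSub 0 y + coordSub 1 v / coordSub 1 y + coordSub 2 v / coordSub 2 y

/-- The product of the powers `(y k - y 3) ^ r` for `k = 0, 1, 2`. -/
noncomputable def rpowProd (r : ℝ) (y : Fin 4 → ℝ) : ℝ :=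
  (y 0 - y 3) ^ r * (y 1 - y 3) ^ r * (y 2 - y 3) ^ r

lemma exists_hasFDerivAt_rpowProd (r : ℝ) {y : Fin 4 → ℝ}
    (h0 : 0 < coordSub 0 y) (h1 : 0 < coordSub 1 y) (h2 : 0 < coordSub 2 y) :
    ∃ f' : (Fin 4 → ℝ) →L[ℝ] ℝ, HasFDerivAt (rpowProd r) f' y ∧
      ∀ v, f' v = r * rpowProd r y * logDerivSum v y := by
  have d (k : Fin 4) (hk : 0 < coordSub k y) :=
    (coordSub k).hasFDerivAt (x := y) |>.rpow_const (p := r) (Or.inl hk.ne')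
  refine ⟨_, ((d 0 h0).mul (d 1 h1)).mul (d 2 h2), fun v => ?_⟩
  simp only [Real.rpow_sub_one h0.ne', Real.rpow_sub_one h1.ne', Real.rpow_sub_one h2.ne',
    logDerivSum, rpowProd, ← coordSub_apply, Pi.mul_apply, add_apply,
    smul_apply, smul_eq_mul]
  field_simp
  ring

lemma pd_rpowProd (r : ℝ) (j : Fin 4) {y : Fin 4 → ℝ}
    (h0 : 0 < coordSub 0 y) (h1 : 0 < coordSub 1 y) (h2 : 0 < coordSub 2 y) :
    pd (rpowProd r) j y = r * rpowProd r y * logDerivSum (Pi.single j 1) y := by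
  obtain ⟨f', hf, hv⟩ := exists_hasFDerivAt_rpowProd r h0 h1 h2
  rw [pd, hf.fderiv, hv]

lemma pd2_rpowProd (r : ℝ) (i j : Fin 4) {x : Fin 4 → ℝ}
    (h0 : 0 < coordSub 0 x) (h1 : 0 < coordSub 1 x) (h2 : 0 < coordSub 2 x) :
    pd2 (rpowProd r) i j x = r * rpowProd r x *
      (r * logDerivSum (Pi.single i 1) x * logDerivSum (Pi.single j 1) x -
        (coordSub 0 (Pi.single i 1) * coordSub 0 (Pi.single j 1) / coordSub 0 x ^ 2 +
         coordSub 1 (Pi.single i 1) * coordSub 1 (Pi.single j 1) / coordSub 1 x ^ 2 +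
         coordSub 2 (Pi.single i 1) * coordSub 2 (Pi.single j 1) / coordSub 2 x ^ 2)) := by
  have hpos (k : Fin 4) (hk : 0 < coordSub k x) : ∀ᶠ y in nhds x, 0 < coordSub k y :=
    (coordSub k).continuous.continuousAt.eventually_const_lt hk
  have heq : pd (rpowProd r) j =ᶠ[nhds x]
      fun y => r * rpowProd r y * logDerivSum (Pi.single j 1) y := by
    filter_upwards [hpos 0 h0, hpos 1 h1, hpos 2 h2] with y using pd_rpowProd r j
  obtain ⟨f', hf, hv⟩ := exists_hasFDerivAt_rpowProd r h0 h1 h2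
  have d (k : Fin 4) (hk : 0 < coordSub k x) :=
    ((hasDerivAt_inv hk.ne').comp_hasFDerivAt x (coordSub k).hasFDerivAt).const_mul
      (coordSub k (Pi.single j 1))
  have hS : HasFDerivAt (logDerivSum (Pi.single j 1)) _ x := ((d 0 h0).add (d 1 h1)).add (d 2 h2)
  have hmul := (hf.const_mul r).mul hS
  rw [pd2, pd, heq.fderiv_eq]
  refine (congrArg (fun L : (Fin 4 → ℝ) →L[ℝ] ℝ => L (Pi.single i 1)) hmul.fderiv).trans ?_
  simp only [smul_apply, add_apply, smul_eq_mul, hv]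
  ring

/-- For every `r ∈ ℝ`, the function
`f = (x₁−x₄)^r (x₂−x₄)^r (x₃−x₄)^r` (real powers) on
`U = {x : x₁ > x₄, x₂ > x₄, x₃ > x₄}` satisfies all four equations of the
dispersionless Hirota system (case A₀). -/
theorem rpow_solution_hirota_A0 (r : ℝ) :
    ∀ x : Fin 4 → ℝ, x 0 > x 3 → x 1 > x 3 → x 2 > x 3 →
      (let f : (Fin 4 → ℝ) → ℝ :=
        fun y => (y 0 - y 3) ^ r * (y 1 - y 3) ^ r * (y 2 - y 3) ^ r
       (pd f 0 x * pd2 f 1 2 x * (x 1 - x 2) + pd f 1 x * pd2 f 0 2 x * (x 2 - x 0)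
          + pd f 2 x * pd2 f 0 1 x * (x 0 - x 1) = 0)
       ∧
       (pd f 0 x * pd2 f 1 3 x * (x 1 - x 3) + pd f 1 x * pd2 f 0 3 x * (x 3 - x 0)
          + pd f 3 x * pd2 f 0 1 x * (x 0 - x 1) = 0)
       ∧
       (pd f 0 x * pd2 f 2 3 x * (x 2 - x 3) + pd f 2 x * pd2 f 0 3 x * (x 3 - x 0)
          + pd f 3 x * pd2 f 0 2 x * (x 0 - x 2) = 0)
       ∧
       (pd f 1 x * pd2 f 2 3 x * (x 2 - x 3) + pd f 2 x * pd2 f 1 3 x * (x 3 - x 1)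
          + pd f 3 x * pd2 f 1 2 x * (x 1 - x 2) = 0)) := by
  intro x h0 h1 h2 f
  have p0 : 0 < coordSub 0 x := sub_pos.2 h0
  have p1 : 0 < coordSub 1 x := sub_pos.2 h1
  have p2 : 0 < coordSub 2 x := sub_pos.2 h2
  have hf : f = rpowProd r := rfl
  have e01 : x 0 - x 1 = coordSub 0 x - coordSub 1 x := by simp [coordSub_apply]
  have e12 : x 1 - x 2 = coordSub 1 x - coordSub 2 x := by simp [coordSub_apply]
  have e02 : x 0 - x 2 = coordSub 0 x - coordSub 2 x := by simp [coordSub_apply]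
  have e20 : x 2 - x 0 = coordSub 2 x - coordSub 0 x := by simp [coordSub_apply]
  have e30 : x 3 - x 0 = -coordSub 0 x := by simp [coordSub_apply]
  have e31 : x 3 - x 1 = -coordSub 1 x := by simp [coordSub_apply]
  simp only [hf, pd_rpowProd r _ p0 p1 p2, pd2_rpowProd r _ _ p0 p1 p2, logDerivSum,
    e01, e12, e02, e20, e30, e31, ← coordSub_apply]
  have hc (k j : Fin 4) : coordSub k (Pi.single j 1) =
      (if k = j then 1 else 0) - (if 3 = j then 1 else 0) := by
    simp [coordSub_apply, Pi.single_apply]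
  simp only [hc, Fin.reduceEq, if_true, if_false]
  generalize rpowProd r x = F
  refine ⟨?_, ?_, ?_, ?_⟩ <;> field_simp <;> ring
end
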